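/- Let $\Omega_0$ be a neighborhood of $0$ and $\Gamma$ a simple contour in $\mathbb{C}$. Let $p_i, f_i$ be analytic in $\Omega_0$ with $f_i(0) = p_i(0) = 1$, and let $q_i, g_i$ be square-integrable continuous functions on $\Gamma$ for $1\le i\le n$. Suppose $H(v,u)$, defined on $\Omega_0\times\Gamma$ and analytic in $v$ at $0$, satisfies $\frac{1}{2\pi i}\oint_0 \frac{f_i(v)}{v^i}H(v,u)\,dv = g_i(u)$ for all $1\le i\le n$ and $u\in\Gamma$. Then $\det\left[\frac{1}{2\pi i}\oint_0 v^{i-j-1} p_i(v) f_j(v)\,dv + \frac{1}{2\pi i}\int_\Gamma q_i(u) g_j(u)\,du\right]_{i,j=1}^{n} = \det(I+K)$, where $K$ is the integral operator on $L^2(\Gamma, du/2\pi i)$ with kernel $K(u_1,u_2) = \sum_{\ell=1}^{n} q_\ell(u_1) \oint\frac{dv_1}{2\pi i}\cdots\oint\frac{dv_\ell}{2\pi i}\; \frac{H(v_1,u_2)}{\left[\prod_{i=1}^{\ell-1}(v_i-v_{i+1})\right]\cdot\left[\prod_{i=1}^{\ell} v_i P_i(v_i)\right]}$, with $P_1 =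 p_1$, $P_i = p_i/p_{i-1}$ for $2\le i\le n$, and nested small circular contours $|v_1| > |v_2| > \cdots$ around the origin. -/

import Mathlib

open Finset MeasureTheory intervalIntegral

/-- `(2πi)⁻¹ ∮_{|v|=r} f(v) dv`. -/
noncomputable def cInt (r : ℝ) (f : ℂ → ℂ) : ℂ :=
  (2 * Real.pi * Complex.I)⁻¹ * ∮ v in C(0, r), f v

/-- Iterated (nested) contour integrals: `j` counterclockwise circles around `0` of radii
`r 0 > r 1 > ⋯ > r (j-1)`, each integral carrying the factor `(2πi)⁻¹`. -/
noncomputable def nestedCI : ℕ → (ℕ → ℝ) → ((ℕ → ℂ) → ℂ) → ℂ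
  | 0, _, F => F fun _ => 0
  | j+1, r, F => cInt (r 0) fun v =>
      nestedCI j (fun k => r (k+1)) fun w => F fun k => match k with
        | 0 => v
        | k+1 => w k

/-- Fredholm determinant `det(I + K)` of a kernel on the parameter interval `[0,1]`,
via the Fredholm series `∑ₖ (1/k!) ∫⋯∫ det[K(tᵢ,tⱼ)] dt₁⋯dtₖ`. -/
noncomputable def fredholmDet (K : ℝ → ℝ → ℂ) : ℂ :=
  ∑' k : ℕ, ((k.factorial : ℂ))⁻¹ *
    ∫ t : Fin k → ℝ, (Matrix.of fun i j => K (t i) (t j)).det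
      ∂(Measure.pi fun _ => volume.restrict (Set.Icc 0 1))

theorem cInt_congr {r : ℝ} (hr : 0 < r) {f g : ℂ → ℂ}
    (h : ∀ v ∈ Metric.sphere (0 : ℂ) r, f v = g v) : cInt r f = cInt r g := by
  rw [cInt, cInt, circleIntegral.integral_congr hr.le h]

theorem cInt_const_mul (r : ℝ) (a : ℂ) (f : ℂ → ℂ) :
    cInt r (fun v => a * f v) = a * cInt r f := by
  rw [cInt, cInt, circleIntegral.integral_const_mul]
  ring

theorem cInt_add {r : ℝ} (hr : 0 < r) {f g : ℂ → ℂ} (hf : ContinuousOn f (Metric.sphere 0 r))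
    (hg : ContinuousOn g (Metric.sphere 0 r)) :
    cInt r (fun v => f v + g v) = cInt r f + cInt r g := by
  rw [cInt, cInt, cInt, circleIntegral.integral_add (hf.circleIntegrable hr.le)
    (hg.circleIntegrable hr.le), mul_add]

theorem cInt_sum {ι : Type*} {r : ℝ} (hr : 0 < r) (s : Finset ι) {f : ι → ℂ → ℂ}
    (hf : ∀ i ∈ s, ContinuousOn (f i) (Metric.sphere 0 r)) :
    cInt r (fun v => ∑ i ∈ s, f i v) = ∑ i ∈ s, cInt r (f i) := by
  simp only [cInt]
  rw [circleIntegral.integral_fun_sum fun i hi => (hf i hi).circleIntegrable hr.le,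
    Finset.mul_sum]

theorem cInt_eq_zero_of_differentiableOn {r R : ℝ} (hr : 0 < r) (hrR : r < R) {f : ℂ → ℂ}
    (hf : DifferentiableOn ℂ f (Metric.ball 0 R)) : cInt r f = 0 := by
  have hd : DiffContOnCl ℂ f (Metric.ball 0 r) :=
    (hf.mono (Metric.closedBall_subset_ball hrR)).diffContOnCl_ball subset_rfl
  rw [cInt, Complex.circleIntegral_eq_zero_of_differentiable_on_off_countable hr.le
    Set.countable_empty hd.continuousOn_ball
    fun x hx => hd.differentiableAt Metric.isOpen_ball hx.1, mul_zero]

theorem ne_zero_of_mem_sphere_zero {r : ℝ} (hr : 0 < r) {v : ℂ}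
    (hv : v ∈ Metric.sphere (0 : ℂ) r) : v ≠ 0 :=
  Metric.ne_of_mem_sphere hv hr.ne'

theorem continuousOn_div_pow_sphere {r R : ℝ} (hr : 0 < r) (hrR : r < R) {h : ℂ → ℂ}
    (hh : DifferentiableOn ℂ h (Metric.ball 0 R)) (m : ℕ) :
    ContinuousOn (fun v => h v / v ^ m) (Metric.sphere 0 r) :=
  (hh.continuousOn.mono (Metric.sphere_subset_closedBall.trans
    (Metric.closedBall_subset_ball hrR))).div (by fun_prop)
    fun _ hv => pow_ne_zero m (ne_zero_of_mem_sphere_zero hr hv)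

/-- The `m`-th Taylor coefficient at `0`, obtained by iterating `h ↦ (h - h 0) / v`. -/
noncomputable def taylorCoeff : ℕ → (ℂ → ℂ) → ℂ
  | 0, h => h 0
  | m + 1, h => taylorCoeff m (dslope h 0)

theorem eq_add_mul_dslope_zero (h : ℂ → ℂ) (v : ℂ) : h v = h 0 + v * dslope h 0 v := by
  have := sub_smul_dslope h 0 v
  simp only [sub_zero, smul_eq_mul] at this
  rw [this]
  ring

theorem DifferentiableOn.dslope_zero {R : ℝ} (hR : 0 < R) {h : ℂ → ℂ}
    (hh : DifferentiableOn ℂ h (Metric.ball 0 R)) :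
    DifferentiableOn ℂ (dslope h 0) (Metric.ball 0 R) :=
  (Complex.differentiableOn_dslope (Metric.ball_mem_nhds 0 hR)).2 hh

theorem cInt_div_pow_succ_of_eq {r R : ℝ} (hr : 0 < r) (hrR : r < R) {h G : ℂ → ℂ} {a : ℂ}
    (hG : DifferentiableOn ℂ G (Metric.ball 0 R))
    (heq : ∀ v ∈ Metric.sphere (0 : ℂ) r, h v = a + v * G v) (m : ℕ) :
    cInt r (fun v => h v / v ^ (m + 2)) = cInt r (fun v => G v / v ^ (m + 1)) := by
  have hzpow : cInt r (fun v => v ^ (-(m + 2 : ℤ))) = 0 := by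
    have := circleIntegral.integral_sub_zpow_of_ne (n := -(m + 2 : ℤ)) (by omega) 0 0 r
    simp only [sub_zero] at this
    rw [cInt, this, mul_zero]
  have hsplit : ∀ v ∈ Metric.sphere (0 : ℂ) r,
      h v / v ^ (m + 2) = a * v ^ (-(m + 2 : ℤ)) + G v / v ^ (m + 1) := by
    intro v hv
    have hv0 := ne_zero_of_mem_sphere_zero hr hv
    rw [heq v hv, zpow_neg, show (m + 2 : ℤ) = ((m + 2 : ℕ) : ℤ) by push_cast; ring, zpow_natCast]
    field_simp
    ring
  rw [cInt_congr hr hsplit, cInt_add hr _ (continuousOn_div_pow_sphere hr hrR hG _),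
    cInt_const_mul, hzpow, mul_zero, zero_add]
  exact continuousOn_const.mul (continuousOn_id.zpow₀ _
    fun v hv => Or.inl (ne_zero_of_mem_sphere_zero hr hv))

theorem cInt_div_pow_eq_taylorCoeff {r R : ℝ} (hr : 0 < r) (hrR : r < R) (m : ℕ) {h : ℂ → ℂ}
    (hh : DifferentiableOn ℂ h (Metric.ball 0 R)) :
    cInt r (fun v => h v / v ^ (m + 1)) = taylorCoeff m h := by
  induction m generalizing h with
  | zero =>
    have hd : DiffContOnCl ℂ h (Metric.ball 0 r) :=
      (hh.mono (Metric.closedBall_subset_ball hrR)).diffContOnCl_ball subset_rfl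
    have := hd.two_pi_i_inv_smul_circleIntegral_sub_inv_smul (Metric.mem_ball_self hr)
    simp only [sub_zero, smul_eq_mul] at this
    rw [taylorCoeff, ← this, cInt]
    congr 2
    ext v
    rw [zero_add, pow_one, div_eq_inv_mul]
  | succ m ih =>
    rw [taylorCoeff, ← ih (hh.dslope_zero (hr.trans hrR))]
    exact cInt_div_pow_succ_of_eq hr hrR (hh.dslope_zero (hr.trans hrR))
      (fun v _ => eq_add_mul_dslope_zero h v) m

theorem taylorCoeff_succ_of_eq {R : ℝ} (hR : 0 < R) {h G : ℂ → ℂ} {a : ℂ}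
    (hh : DifferentiableOn ℂ h (Metric.ball 0 R)) (hG : DifferentiableOn ℂ G (Metric.ball 0 R))
    (heq : ∀ v ∈ Metric.ball (0 : ℂ) R, h v = a + v * G v) (m : ℕ) :
    taylorCoeff (m + 1) h = taylorCoeff m G := by
  have hr : 0 < R / 2 := by linarith
  have hrR : R / 2 < R := by linarith
  rw [← cInt_div_pow_eq_taylorCoeff hr hrR _ hh, ← cInt_div_pow_eq_taylorCoeff hr hrR _ hG]
  exact cInt_div_pow_succ_of_eq hr hrR hG (fun v hv => heq v
    (Metric.closedBall_subset_ball hrR (Metric.sphere_subset_closedBall hv))) m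

theorem taylorCoeff_congr {R : ℝ} (hR : 0 < R) {h G : ℂ → ℂ}
    (hG : DifferentiableOn ℂ G (Metric.ball 0 R))
    (heq : ∀ v ∈ Metric.ball (0 : ℂ) R, h v = G v) (m : ℕ) :
    taylorCoeff m h = taylorCoeff m G := by
  have hr : 0 < R / 2 := by linarith
  have hrR : R / 2 < R := by linarith
  rw [← cInt_div_pow_eq_taylorCoeff hr hrR _ (hG.congr heq),
    ← cInt_div_pow_eq_taylorCoeff hr hrR _ hG]
  exact cInt_congr hr fun v hv => by
    rw [heq v (Metric.closedBall_subset_ball hrR (Metric.sphere_subset_closedBall hv))]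

theorem taylorCoeff_add {R : ℝ} (hR : 0 < R) {h G : ℂ → ℂ}
    (hh : DifferentiableOn ℂ h (Metric.ball 0 R)) (hG : DifferentiableOn ℂ G (Metric.ball 0 R))
    (m : ℕ) : taylorCoeff m (fun v => h v + G v) = taylorCoeff m h + taylorCoeff m G := by
  have hr : 0 < R / 2 := by linarith
  have hrR : R / 2 < R := by linarith
  rw [← cInt_div_pow_eq_taylorCoeff hr hrR _ (hh.fun_add hG),
    ← cInt_div_pow_eq_taylorCoeff hr hrR _ hh, ← cInt_div_pow_eq_taylorCoeff hr hrR _ hG,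
    ← cInt_add hr (continuousOn_div_pow_sphere hr hrR hh _)
      (continuousOn_div_pow_sphere hr hrR hG _)]
  simp only [add_div]

theorem taylorCoeff_const_mul {R : ℝ} (hR : 0 < R) {h : ℂ → ℂ} (a : ℂ)
    (hh : DifferentiableOn ℂ h (Metric.ball 0 R)) (m : ℕ) :
    taylorCoeff m (fun v => a * h v) = a * taylorCoeff m h := by
  have hr : 0 < R / 2 := by linarith
  have hrR : R / 2 < R := by linarith
  rw [← cInt_div_pow_eq_taylorCoeff hr hrR _ (hh.const_mul a),
    ← cInt_div_pow_eq_taylorCoeff hr hrR _ hh, ← cInt_const_mul]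
  simp only [mul_div_assoc]

theorem taylorCoeff_const_div_sub {z : ℂ} (hz : z ≠ 0) (a : ℂ) (m : ℕ) :
    taylorCoeff m (fun w => a / (z - w)) = a / z ^ (m + 1) := by
  have hd : ∀ a : ℂ, DifferentiableOn ℂ (fun w => a / (z - w)) (Metric.ball 0 ‖z‖) := by
    intro a w hw
    have : z - w ≠ 0 := by
      rintro h
      rw [sub_eq_zero] at h
      simp [h] at hw
    exact ((differentiableAt_const a).div (by fun_prop) this).differentiableWithinAt
  have hR : 0 < ‖z‖ := norm_pos_iff.2 hz
  induction m generalizing a with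
  | zero => simp [taylorCoeff]
  | succ m ih =>
    rw [taylorCoeff_succ_of_eq hR (hd a) (hd (a / z)) (a := a / z), ih, pow_succ z (m + 1)]
    · field_simp
    · intro w hw
      have : z - w ≠ 0 := by
        rintro h
        rw [sub_eq_zero] at h
        simp [h] at hw
      field_simp
      ring

/-- The Taylor coefficients of a product `h φ` are combinations of those of `h`, with
coefficients depending only on `φ`. -/
theorem exists_taylorCoeff_mul_eq_sum {R₀ : ℝ} {φ : ℂ → ℂ}
    (hφ : DifferentiableOn ℂ φ (Metric.ball 0 R₀)) (m : ℕ) :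
    ∃ b : ℕ → ℂ, ∀ R : ℝ, 0 < R → R ≤ R₀ → ∀ h : ℂ → ℂ,
      DifferentiableOn ℂ h (Metric.ball 0 R) →
      taylorCoeff m (fun v => h v * φ v) = ∑ k ∈ range (m + 1), b k * taylorCoeff k h := by
  induction m with
  | zero => exact ⟨fun _ => φ 0, fun R _ _ h _ => by simp [taylorCoeff, mul_comm]⟩
  | succ m ih =>
    obtain ⟨b, hb⟩ := ih
    refine ⟨fun k => match k with
      | 0 => taylorCoeff (m + 1) φ
      | k + 1 => b k, fun R hR hRR h hh => ?_⟩
    have hφR := hφ.mono (Metric.ball_subset_ball hRR)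
    have hD := hh.dslope_zero hR
    have hDφ := hφR.dslope_zero hR
    rw [taylorCoeff_succ_of_eq hR (hh.fun_mul hφR) (a := h 0 * φ 0)
      (G := fun v => dslope h 0 v * φ v + h 0 * dslope φ 0 v)
      ((hD.fun_mul hφR).fun_add (hDφ.const_mul _)),
      taylorCoeff_add hR (hD.fun_mul hφR) (hDφ.const_mul _), hb R hR hRR _ hD,
      taylorCoeff_const_mul hR _ hDφ, Finset.sum_range_succ' _ (m + 1)]
    · simp only [taylorCoeff]
      ring
    · intro v _
      linear_combination φ v * eq_add_mul_dslope_zero h v + h 0 * eq_add_mul_dslope_zero φ v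

/-- The `ℓ`-th nested contour integral of the kernel, with a general function `h` in place of
`H(·, u)`. -/
noncomputable def nestedKernel (ℓ : ℕ) (ρ : ℕ → ℝ) (P : ℕ → ℂ → ℂ) (h : ℂ → ℂ) : ℂ :=
  nestedCI (ℓ + 1) ρ fun v => h (v 0) / ((∏ m ∈ range ℓ, (v m - v (m + 1))) *
    ∏ m ∈ range (ℓ + 1), (v m * P m (v m)))

theorem nestedKernel_zero {ρ : ℕ → ℝ} {R : ℝ} (hρ : 0 < ρ 0) (hρR : ρ 0 < R) {P : ℕ → ℂ → ℂ}
    (hP : DifferentiableOn ℂ (P 0) (Metric.ball 0 R)) (hP0 : ∀ v ∈ Metric.ball 0 R, P 0 v ≠ 0)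
    {h : ℂ → ℂ} (hh : DifferentiableOn ℂ h (Metric.ball 0 R)) :
    nestedKernel 0 ρ P h = h 0 / P 0 0 := by
  have := cInt_div_pow_eq_taylorCoeff hρ hρR 0 (hh.fun_div hP hP0)
  rw [taylorCoeff] at this
  rw [← this, nestedKernel, nestedCI]
  congr 1
  ext v
  simp [nestedCI, div_div, mul_comm]

theorem nestedKernel_succ_eq_cInt (ℓ : ℕ) (ρ : ℕ → ℝ) (P : ℕ → ℂ → ℂ) (h : ℂ → ℂ) :
    nestedKernel (ℓ + 1) ρ P h = cInt (ρ 0) fun v =>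
      nestedKernel ℓ (fun k => ρ (k + 1)) (fun m => P (m + 1))
        fun w => h v / (v * P 0 v) / (v - w) := by
  rw [nestedKernel, nestedCI]
  congr 1
  ext v
  rw [nestedKernel]
  congr 1
  ext w
  rw [Finset.prod_range_succ' _ ℓ, Finset.prod_range_succ' _ (ℓ + 1)]
  simp only [div_div]
  congr 1
  ring

/-- If the nested integral over the inner circles is a combination of Taylor coefficients, so is
the one with an additional outer circle. -/
theorem nestedKernel_succ_eq_sum {R R₀ : ℝ} (hRR : R ≤ R₀) {ℓ : ℕ} {P : ℕ → ℂ → ℂ} {ρ : ℕ → ℝ}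
    (hρ : ∀ k, 0 < ρ k) (hρR : ρ 0 < R) (hρdec : ∀ k, ρ (k + 1) < ρ k) {c : ℕ → ℂ}
    (hc : ∀ S : ℝ, S ≤ R₀ → ∀ ρ : ℕ → ℝ, (∀ k, 0 < ρ k) → ρ 0 < S →
      (∀ k, ρ (k + 1) < ρ k) → ∀ h : ℂ → ℂ, DifferentiableOn ℂ h (Metric.ball 0 S) →
      nestedKernel ℓ ρ (fun m => P (m + 1)) h = ∑ m ∈ range (ℓ + 1), c m * taylorCoeff m h)
    (hP : DifferentiableOn ℂ (P 0) (Metric.ball 0 R)) (hP0 : ∀ v ∈ Metric.ball 0 R, P 0 v ≠ 0)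
    {h : ℂ → ℂ} (hh : DifferentiableOn ℂ h (Metric.ball 0 R)) :
    nestedKernel (ℓ + 1) ρ P h =
      ∑ m ∈ range (ℓ + 1), c m * taylorCoeff (m + 1) (fun v => h v / P 0 v) := by
  have hF := hh.fun_div hP hP0
  have hinner : ∀ v ∈ Metric.sphere (0 : ℂ) (ρ 0),
      nestedKernel ℓ (fun k => ρ (k + 1)) (fun m => P (m + 1))
        (fun w => h v / (v * P 0 v) / (v - w)) =
      ∑ m ∈ range (ℓ + 1), c m * (h v / P 0 v / v ^ (m + 2)) := by
    intro v hv
    have hv0 := ne_zero_of_mem_sphere_zero (hρ 0) hv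
    have hd : DifferentiableOn ℂ (fun w => h v / (v * P 0 v) / (v - w))
        (Metric.ball 0 (ρ 0)) := by
      intro w hw
      have : v - w ≠ 0 := by
        intro h
        rw [sub_eq_zero] at h
        rw [mem_sphere_zero_iff_norm] at hv
        rw [mem_ball_zero_iff, ← h, hv] at hw
        exact hw.false
      exact ((differentiableAt_const _).div (by fun_prop) this).differentiableWithinAt
    rw [hc (ρ 0) (hρR.le.trans hRR) _ (fun k => hρ (k + 1)) (hρdec 0)
      (fun k => hρdec (k + 1)) _ hd]
    refine Finset.sum_congr rfl fun m _ => ?_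
    rw [taylorCoeff_const_div_sub hv0, div_div, div_div]
    congr 2
    ring
  rw [nestedKernel_succ_eq_cInt, cInt_congr (hρ 0) hinner, cInt_sum (hρ 0)]
  · refine Finset.sum_congr rfl fun m _ => ?_
    rw [cInt_const_mul, ← cInt_div_pow_eq_taylorCoeff (hρ 0) hρR (m + 1) hF]
  · exact fun m _ => continuousOn_const.mul (continuousOn_div_pow_sphere (hρ 0) hρR hF (m + 2))

/-- The nested contour integral only depends on finitely many Taylor coefficients of `h`. -/
theorem exists_nestedKernel_eq_sum {R₀ : ℝ} (ℓ : ℕ) {P : ℕ → ℂ → ℂ}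
    (hP : ∀ m, DifferentiableOn ℂ (P m) (Metric.ball 0 R₀))
    (hP0 : ∀ m, ∀ v ∈ Metric.ball 0 R₀, P m v ≠ 0) :
    ∃ c : ℕ → ℂ, ∀ R : ℝ, R ≤ R₀ → ∀ ρ : ℕ → ℝ, (∀ k, 0 < ρ k) → ρ 0 < R →
      (∀ k, ρ (k + 1) < ρ k) → ∀ h : ℂ → ℂ, DifferentiableOn ℂ h (Metric.ball 0 R) →
      nestedKernel ℓ ρ P h = ∑ m ∈ range (ℓ + 1), c m * taylorCoeff m h := by
  induction ℓ generalizing P with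
  | zero =>
    refine ⟨fun _ => (P 0 0)⁻¹, fun R hRR ρ hρ hρR _ h hh => ?_⟩
    have hsub := Metric.ball_subset_ball (x := (0 : ℂ)) hRR
    rw [nestedKernel_zero (hρ 0) hρR ((hP 0).mono hsub) (fun v hv => hP0 0 v (hsub hv)) hh]
    simp [taylorCoeff, div_eq_inv_mul]
  | succ ℓ ih =>
    obtain ⟨c, hc⟩ := ih (fun m => hP (m + 1)) fun m => hP0 (m + 1)
    choose b hb using exists_taylorCoeff_mul_eq_sum ((hP 0).fun_inv (hP0 0))
    refine ⟨fun k => ∑ m ∈ range (ℓ + 1), if k < m + 2 then c m * b (m + 1) k else 0,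
      fun R hRR ρ hρ hρR hρdec h hh => ?_⟩
    have hsub := Metric.ball_subset_ball (x := (0 : ℂ)) hRR
    rw [nestedKernel_succ_eq_sum hRR hρ hρR hρdec hc ((hP 0).mono hsub)
      (fun v hv => hP0 0 v (hsub hv)) hh]
    simp only [Finset.sum_mul]
    rw [Finset.sum_comm]
    refine Finset.sum_congr rfl fun m hm => ?_
    simp only [div_eq_mul_inv]
    rw [hb (m + 1) R ((hρ 0).trans hρR) hRR h hh, Finset.mul_sum]
    simp only [ite_mul, zero_mul]
    rw [← Finset.sum_filter]
    refine Finset.sum_congr ?_ fun k _ => by ring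
    ext k
    simp only [mem_range, mem_filter] at hm ⊢
    omega

theorem nestedKernel_succ {R : ℝ} (ℓ : ℕ) {P : ℕ → ℂ → ℂ} {ρ : ℕ → ℝ}
    (hρ : ∀ k, 0 < ρ k) (hρR : ρ 0 < R) (hρdec : ∀ k, ρ (k + 1) < ρ k)
    (hP : ∀ m, DifferentiableOn ℂ (P m) (Metric.ball 0 R))
    (hP0 : ∀ m, ∀ v ∈ Metric.ball 0 R, P m v ≠ 0)
    {h : ℂ → ℂ} (hh : DifferentiableOn ℂ h (Metric.ball 0 R)) :
    nestedKernel (ℓ + 1) ρ P h =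
      nestedKernel ℓ (fun k => ρ (k + 1)) (fun m => P (m + 1))
        (dslope (fun v => h v / P 0 v) 0) := by
  obtain ⟨c, hc⟩ := exists_nestedKernel_eq_sum ℓ (P := fun m => P (m + 1))
    (fun m => hP (m + 1)) fun m => hP0 (m + 1)
  rw [nestedKernel_succ_eq_sum le_rfl hρ hρR hρdec hc (hP 0) (hP0 0) hh,
    hc R le_rfl _ (fun k => hρ (k + 1)) ((hρdec 0).trans hρR) (fun k => hρdec (k + 1)) _
      ((hh.fun_div (hP 0) (hP0 0)).dslope_zero ((hρ 0).trans hρR))]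
  rfl

/-- The nested contour integrals are the coefficients of `s 0 * h` in the expansion with respect
to the functions `v ^ ℓ * s (ℓ + 1) v`, tested here against a function `f`. -/
theorem taylorCoeff_mul_eq_sum_nestedKernel {R : ℝ} (j : ℕ) {s : ℕ → ℂ → ℂ} {ρ : ℕ → ℝ}
    (hρ : ∀ k, 0 < ρ k) (hρR : ρ 0 < R) (hρdec : ∀ k, ρ (k + 1) < ρ k)
    (hs : ∀ m, DifferentiableOn ℂ (s m) (Metric.ball 0 R))
    (hs0 : ∀ m, ∀ v ∈ Metric.ball 0 R, s m v ≠ 0)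
    {f h : ℂ → ℂ} (hf : DifferentiableOn ℂ f (Metric.ball 0 R))
    (hh : DifferentiableOn ℂ h (Metric.ball 0 R)) :
    taylorCoeff j (fun v => f v * (s 0 v * h v)) =
      ∑ ℓ ∈ range (j + 1), taylorCoeff (j - ℓ) (fun v => s (ℓ + 1) v * f v) *
        nestedKernel ℓ ρ (fun m v => s (m + 1) v / s m v) h := by
  have hR : 0 < R := (hρ 0).trans hρR
  have hP : ∀ m, DifferentiableOn ℂ (fun v => s (m + 1) v / s m v) (Metric.ball 0 R) :=
    fun m => (hs (m + 1)).fun_div (hs m) (hs0 m)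
  have hP0 : ∀ m, ∀ v ∈ Metric.ball 0 R, s (m + 1) v / s m v ≠ 0 :=
    fun m v hv => div_ne_zero (hs0 (m + 1) v hv) (hs0 m v hv)
  have h00 : ∀ m, s m 0 ≠ 0 := fun m => hs0 m 0 (Metric.mem_ball_self hR)
  have hzero : nestedKernel 0 ρ (fun m v => s (m + 1) v / s m v) h = h 0 / (s 1 0 / s 0 0) :=
    nestedKernel_zero (hρ 0) hρR (hP 0) (hP0 0) hh
  induction j generalizing s ρ h with
  | zero =>
    have := h00 0
    have := h00 1
    rw [Finset.sum_range_one, hzero]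
    simp only [Nat.sub_self, taylorCoeff, zero_add]
    field_simp
  | succ j ih =>
    set F : ℂ → ℂ := fun v => h v / (s 1 v / s 0 v) with hFdef
    have hF : DifferentiableOn ℂ F (Metric.ball 0 R) := hh.fun_div (hP 0) (hP0 0)
    have hD := hF.dslope_zero hR
    have hsplit : taylorCoeff (j + 1) (fun v => f v * (s 0 v * h v)) =
        taylorCoeff (j + 1) (fun v => s 1 v * f v) * F 0 +
          taylorCoeff j (fun v => f v * (s 1 v * dslope F 0 v)) := by
      have hsf := (hs 1).fun_mul hf
      have hG := hf.fun_mul ((hs 1).fun_mul hD)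
      have hvG : DifferentiableOn ℂ (fun v => v * (f v * (s 1 v * dslope F 0 v)))
        (Metric.ball 0 R) := differentiableOn_id.fun_mul hG
      rw [taylorCoeff_congr hR ((hsf.const_mul (F 0)).fun_add hvG),
        taylorCoeff_add hR (hsf.const_mul _) hvG, taylorCoeff_const_mul hR _ hsf, mul_comm,
        taylorCoeff_succ_of_eq hR hvG hG (a := 0) fun v _ => by rw [zero_add]]
      intro v hv
      have h1 := hs0 1 v hv
      have h2 := hs0 0 v hv
      have h3 : s 0 v * h v = s 1 v * F v := by
        simp only [hFdef]
        field_simp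
      rw [h3, eq_add_mul_dslope_zero F v]
      ring
    rw [Finset.sum_range_succ', hzero, hsplit, add_comm]
    congr 1
    rw [ih (s := fun m => s (m + 1)) (ρ := fun k => ρ (k + 1)) (h := dslope F 0)
      (fun k => hρ (k + 1)) ((hρdec 0).trans hρR) (fun k => hρdec (k + 1)) (fun m => hs (m + 1))
      (fun m => hs0 (m + 1)) hD (fun m => hP (m + 1)) (fun m => hP0 (m + 1))
      (fun m => h00 (m + 1))
      (nestedKernel_zero (hρ 1) ((hρdec 0).trans hρR) (hP 1) (hP0 1) hD)]
    refine Finset.sum_congr rfl fun ℓ _ => ?_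
    rw [nestedKernel_succ ℓ hρ hρR hρdec hP hP0 hh, Nat.add_sub_add_right]

/-- Summing the minors `det (M (φ i) (φ j))` over all maps `φ : Fin k → ι` counts every principal
`k × k` minor of `M` exactly `k!` times. -/
theorem sum_det_submatrix_eq_factorial_mul {ι : Type*} [Fintype ι] [DecidableEq ι]
    (M : Matrix ι ι ℂ) (k : ℕ) :
    ∑ φ : Fin k → ι, (M.submatrix φ φ).det =
      k.factorial * ∑ s ∈ (univ : Finset ι).powersetCard k,
        (M.submatrix (Subtype.val : s → ι) (Subtype.val : s → ι)).det := by
  classical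
  have hinj : ∑ φ : Fin k → ι, (M.submatrix φ φ).det =
      ∑ φ ∈ univ.filter (fun φ : Fin k → ι => Function.Injective φ), (M.submatrix φ φ).det := by
    refine (Finset.sum_filter_of_ne fun φ _ hφ => ?_).symm
    intro i j hij
    by_contra hne
    exact hφ (Matrix.det_zero_of_row_eq hne (by ext x; simp [hij]))
  rw [hinj, Finset.mul_sum, ← Finset.sum_fiberwise_of_maps_to
    (s := univ.filter (fun φ : Fin k → ι => Function.Injective φ))
    (t := univ.powersetCard k) (g := fun φ => univ.image φ)]
  · refine Finset.sum_congr rfl fun s hs => ?_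
    have hcard : s.card = k := (Finset.mem_powersetCard.1 hs).2
    have hsum : ∑ e : Fin k ≃ s, (M.submatrix (Subtype.val : s → ι) (Subtype.val : s → ι)).det =
        k.factorial * (M.submatrix (Subtype.val : s → ι) (Subtype.val : s → ι)).det := by
      rw [Finset.sum_const, Finset.card_univ,
        Fintype.card_equiv (Fintype.equivOfCardEq (by simp [hcard])), Fintype.card_fin, nsmul_eq_mul]
    rw [← hsum]
    symm
    refine Finset.sum_bij (fun e _ => fun i => (e i : ι)) ?_ ?_ ?_ ?_
    · intro e _
      simp only [mem_filter, mem_univ, true_and]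
      refine ⟨Subtype.val_injective.comp e.injective, ?_⟩
      ext x
      simp only [mem_image, mem_univ, true_and]
      constructor
      · rintro ⟨i, rfl⟩
        exact (e i).2
      · intro hx
        exact ⟨e.symm ⟨x, hx⟩, by simp⟩
    · intro e _ e' _ h
      ext i
      exact congrFun h i
    · intro φ hφ
      simp only [mem_filter, mem_univ, true_and] at hφ
      obtain ⟨hφi, hφs⟩ := hφ
      have hmem : ∀ i, φ i ∈ s := fun i => hφs ▸ mem_image_of_mem φ (mem_univ i)
      refine ⟨Equiv.ofBijective (fun i => ⟨φ i, hmem i⟩)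
        ⟨fun i j h => hφi (congrArg Subtype.val h), fun y => ?_⟩, mem_univ _, rfl⟩
      · obtain ⟨i, _, hi⟩ := mem_image.1 (hφs.symm ▸ y.2 : (y : ι) ∈ univ.image φ)
        exact ⟨i, Subtype.ext hi⟩
    · intro e _
      rw [← Matrix.det_submatrix_equiv_self e]
      rfl
  · intro φ hφ
    simp only [mem_filter, mem_univ, true_and] at hφ
    simp [Finset.mem_powersetCard, Finset.card_image_of_injective _ hφ]

theorem det_one_add_eq_sum_minors {ι : Type*} [Fintype ι] [DecidableEq ι] (M : Matrix ι ι ℂ) :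
    (1 + M).det = ∑ k ∈ Finset.range (Fintype.card ι + 1),
      ∑ s ∈ (univ : Finset ι).powersetCard k,
        (M.submatrix (Subtype.val : s → ι) (Subtype.val : s → ι)).det := by
  have heval : (1 + M).det =
      (Matrix.det (1 + (Polynomial.X : Polynomial ℂ) • M.map Polynomial.C)).eval 1 := by
    rw [← Polynomial.coe_evalRingHom, RingHom.map_det]
    congr 1
    ext i j
    by_cases h : i = j <;> simp [h]
  rw [heval, Polynomial.eval_eq_sum_range' (n := Fintype.card ι + 1)]
  · simp [Matrix.coeff_det_one_add_X_smul_eq_sum_minors]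
  · refine Nat.lt_succ_of_le (Polynomial.natDegree_le_iff_coeff_eq_zero.2 fun k hk => ?_)
    rw [Matrix.coeff_det_one_add_X_smul_eq_sum_minors, Finset.powersetCard_eq_empty.2 (by simpa),
      Finset.sum_empty]

theorem det_sum_mul_eq_sum {ι : Type*} [Fintype ι] {k : ℕ} (a b : Fin k → ι → ℂ) :
    (Matrix.of fun i j => ∑ l, a i l * b j l).det =
      ∑ φ : Fin k → ι, ∑ σ : Equiv.Perm (Fin k),
        ((Equiv.Perm.sign σ : ℤ) : ℂ) * ∏ i, (a i (φ i) * b i (φ (σ i))) := by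
  classical
  rw [← Matrix.det_transpose, Matrix.det_apply', Finset.sum_comm,
    ← Equiv.sum_comp (Equiv.inv (Equiv.Perm (Fin k)))]
  refine Finset.sum_congr rfl fun σ _ => ?_
  simp only [Matrix.transpose_apply, Matrix.of_apply, Finset.prod_univ_sum,
    Fintype.piFinset_univ, Finset.mul_sum, Equiv.inv_apply, Equiv.Perm.sign_inv]
  refine Finset.sum_congr rfl fun φ _ => ?_
  rw [Finset.prod_mul_distrib, Finset.prod_mul_distrib,
    ← Equiv.prod_comp σ fun i => b (σ⁻¹ i) (φ i)]
  simp

/-- The Fredholm determinant of a kernel of finite rank. -/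
theorem fredholmDet_sum_mul {ι : Type*} [Fintype ι] [DecidableEq ι] (a b : ι → ℝ → ℂ)
    (hab : ∀ l m, Integrable (fun t => a l t * b m t) (volume.restrict (Set.Icc 0 1))) :
    fredholmDet (fun s t => ∑ l, a l s * b l t) =
      (1 + Matrix.of fun l m => ∫ t in Set.Icc (0 : ℝ) 1, a l t * b m t).det := by
  set M : Matrix ι ι ℂ := Matrix.of fun l m => ∫ t in Set.Icc (0 : ℝ) 1, a l t * b m t
  have hterm : ∀ k : ℕ, ((k.factorial : ℂ))⁻¹ *
      ∫ t : Fin k → ℝ, (Matrix.of fun i j => ∑ l, a l (t i) * b l (t j)).det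
        ∂(Measure.pi fun _ => volume.restrict (Set.Icc 0 1)) =
      ∑ s ∈ (univ : Finset ι).powersetCard k,
        (M.submatrix (Subtype.val : s → ι) (Subtype.val : s → ι)).det := by
    intro k
    have hint : ∀ (φ : Fin k → ι) (σ : Equiv.Perm (Fin k)),
        Integrable (fun t : Fin k → ℝ => ((Equiv.Perm.sign σ : ℤ) : ℂ) *
          ∏ i, (a (φ i) (t i) * b (φ (σ i)) (t i)))
        (Measure.pi fun _ => volume.restrict (Set.Icc 0 1)) := fun φ σ =>
      (Integrable.fintype_prod (f := fun i t => a (φ i) t * b (φ (σ i)) t)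
        fun i => hab _ _).const_mul _
    have hdet : ∀ t : Fin k → ℝ, (Matrix.of fun i j => ∑ l, a l (t i) * b l (t j)).det =
        ∑ φ : Fin k → ι, ∑ σ : Equiv.Perm (Fin k), ((Equiv.Perm.sign σ : ℤ) : ℂ) *
          ∏ i, (a (φ i) (t i) * b (φ (σ i)) (t i)) := fun t =>
      det_sum_mul_eq_sum (fun i l => a l (t i)) fun i l => b l (t i)
    have hφ : ∀ φ : Fin k → ι, ∫ t : Fin k → ℝ, ∑ σ : Equiv.Perm (Fin k),
        ((Equiv.Perm.sign σ : ℤ) : ℂ) * ∏ i, (a (φ i) (t i) * b (φ (σ i)) (t i))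
          ∂(Measure.pi fun _ => volume.restrict (Set.Icc 0 1)) = (M.submatrix φ φ).det := by
      intro φ
      rw [integral_finsetSum _ fun σ _ => hint φ σ, ← Matrix.det_transpose, Matrix.det_apply']
      refine Finset.sum_congr rfl fun σ _ => ?_
      rw [MeasureTheory.integral_const_mul, integral_fintype_prod_eq_prod
        (f := fun i t => a (φ i) t * b (φ (σ i)) t)]
      rfl
    simp only [hdet]
    rw [integral_finsetSum _ fun φ _ => integrable_finsetSum _ fun σ _ => hint φ σ,
      Finset.sum_congr rfl fun φ _ => hφ φ, sum_det_submatrix_eq_factorial_mul, inv_mul_cancel_left₀]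
    exact_mod_cast k.factorial_ne_zero
  unfold fredholmDet
  simp only [hterm]
  rw [det_one_add_eq_sum_minors, tsum_eq_sum]
  intro k hk
  rw [Finset.powersetCard_eq_empty.2 (by simpa using hk), Finset.sum_empty]

theorem cInt_zpow_mul_mul {r R : ℝ} (hr : 0 < r) (hrR : r < R) {φ ψ : ℂ → ℂ}
    (hφ : DifferentiableOn ℂ φ (Metric.ball 0 R)) (hψ : DifferentiableOn ℂ ψ (Metric.ball 0 R))
    (i j : ℕ) :
    cInt r (fun v => v ^ ((i : ℤ) - (j : ℤ) - 1) * φ v * ψ v) =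
      if i ≤ j then taylorCoeff (j - i) (fun v => φ v * ψ v) else 0 := by
  have hφψ := hφ.fun_mul hψ
  split_ifs with hij
  · obtain ⟨k, rfl⟩ := Nat.exists_eq_add_of_le hij
    rw [Nat.add_sub_cancel_left, ← cInt_div_pow_eq_taylorCoeff hr hrR k hφψ]
    refine cInt_congr hr fun v _ => ?_
    rw [show (i : ℤ) - ((i + k : ℕ) : ℤ) - 1 = -((k + 1 : ℕ) : ℤ) by push_cast; ring, zpow_neg,
      zpow_natCast, mul_assoc, div_eq_inv_mul]
  · obtain ⟨k, rfl⟩ := Nat.exists_eq_add_of_lt (not_le.1 hij)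
    rw [← cInt_eq_zero_of_differentiableOn hr hrR ((differentiableOn_pow (𝕜 := ℂ) k).fun_mul hφψ)]
    refine cInt_congr hr fun v _ => ?_
    rw [show ((j + k + 1 : ℕ) : ℤ) - (j : ℤ) - 1 = (k : ℤ) by push_cast; ring, zpow_natCast,
      mul_assoc]

theorem integrable_mul_deriv_of_continuousOn_image {γ : ℝ → ℂ}
    (hγ : ContDiffOn ℝ 1 γ (Set.Icc 0 1)) {φ : ℂ → ℂ} (hφ : ContinuousOn φ (γ '' Set.Icc 0 1)) :
    Integrable (fun t => φ (γ t) * deriv γ t) (volume.restrict (Set.Icc 0 1)) := by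
  have hcont : ContinuousOn (fun t => φ (γ t) * derivWithin γ (Set.Icc 0 1) t)
      (Set.Icc 0 1) :=
    (hφ.comp hγ.continuousOn (Set.mapsTo_image _ _)).mul
      (hγ.continuousOn_derivWithin (uniqueDiffOn_Icc one_pos) le_rfl)
  have hint := hcont.integrableOn_Icc (μ := volume)
  rw [integrableOn_Icc_iff_integrableOn_Ioo] at hint
  change IntegrableOn _ _ _
  rw [integrableOn_Icc_iff_integrableOn_Ioo]
  refine hint.congr_fun (fun t ht => ?_) measurableSet_Ioo
  simp only [derivWithin_of_mem_nhds (Icc_mem_nhds ht.1 ht.2)]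

/-- Proposition 1.2, the main theorem.  `Ω₀` is a neighborhood of `0`,
`Γ = γ([0,1])` a simple contour (parametrized by the `C¹` injective curve `γ`, with
`du = γ'(t) dt`), `pᵢ, fᵢ` analytic on `Ω₀` with `pᵢ(0) = fᵢ(0) = 1`, `qᵢ, gᵢ` square
integrable continuous functions on `Γ`, and `H(v,u)` analytic in `v`, with
`(2πi)⁻¹∮ fᵢ(v) v^{-i} H(v,u) dv = gᵢ(u)`.  Then
`det[(2πi)⁻¹∮ v^{i-j-1} pᵢ f_j dv + (2πi)⁻¹∫_Γ qᵢ g_j du] = det(I+K)` with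
`K(u₁,u₂) = ∑_ℓ q_ℓ(u₁) ∮⋯∮ H(v₁,u₂)/([∏(vᵢ-v_{i+1})]·[∏ vᵢ Pᵢ(vᵢ)]) (dv/2πi)^ℓ`,
acting on `L²(Γ, du/2πi)`.  All indices are `0`-based: `p i, f i, q i, g i, P i` play the
roles of `p_{i+1}` etc., so `(2πi)⁻¹∮ fᵢ(v)v^{-i}H dv` becomes `cInt r (f i ·/v^{i+1}·H)`
and the `ℓ`-th kernel term has `ℓ+1` integration variables. -/
theorem stmt14 (n : ℕ) (Ω₀ : Set ℂ) (hΩ₀ : Ω₀ ∈ nhds (0 : ℂ))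
    (p f P : ℕ → ℂ → ℂ)
    (hp : ∀ i < n, ∀ v ∈ Ω₀, AnalyticAt ℂ (p i) v)
    (hf : ∀ i < n, ∀ v ∈ Ω₀, AnalyticAt ℂ (f i) v)
    (hp0 : ∀ i < n, p i 0 = 1) (hf0 : ∀ i < n, f i 0 = 1)
    (hP0 : ∀ v, P 0 v = p 0 v)
    (hPs : ∀ ℓ, 0 < ℓ → ∀ v, P ℓ v = p ℓ v / p (ℓ - 1) v)
    (γ : ℝ → ℂ) (hγ : ContDiffOn ℝ 1 γ (Set.Icc 0 1))
    (hγinj : Set.InjOn γ (Set.Icc 0 1))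
    (q g : ℕ → ℂ → ℂ)
    (hqc : ∀ i < n, ContinuousOn (q i) (γ '' Set.Icc 0 1))
    (hgc : ∀ i < n, ContinuousOn (g i) (γ '' Set.Icc 0 1))
    (hqL2 : ∀ i < n, Integrable (fun t => ‖q i (γ t)‖ ^ 2 * ‖deriv γ t‖)
      (volume.restrict (Set.Icc 0 1)))
    (hgL2 : ∀ i < n, Integrable (fun t => ‖g i (γ t)‖ ^ 2 * ‖deriv γ t‖)
      (volume.restrict (Set.Icc 0 1)))
    (H : ℂ → ℂ → ℂ) (R₀ : ℝ) (hR₀ : 0 < R₀) (hball : Metric.closedBall (0 : ℂ) R₀ ⊆ Ω₀)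
    (hH : ∀ u ∈ γ '' Set.Icc 0 1, ∀ v ∈ Metric.closedBall (0 : ℂ) R₀,
      AnalyticAt ℂ (fun w => H w u) v)
    (hpne : ∀ i < n, ∀ v ∈ Metric.closedBall (0 : ℂ) R₀, p i v ≠ 0)
    (r : ℝ) (hr : 0 < r) (hrR : r < R₀)
    (hg : ∀ i < n, ∀ u ∈ γ '' Set.Icc 0 1,
      cInt r (fun v => f i v / v ^ (i + 1) * H v u) = g i u)
    (ρ : ℕ → ℝ) (hρpos : ∀ k, 0 < ρ k) (hρR : ∀ k, ρ k < R₀) (hρdec : ∀ k, ρ (k+1) < ρ k) :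
    (Matrix.of fun i j : Fin n =>
        cInt r (fun v => v ^ ((i : ℤ) - (j : ℤ) - 1) * p i v * f j v) +
          (2 * Real.pi * Complex.I)⁻¹ *
            ∫ t in (0:ℝ)..1, q i (γ t) * g j (γ t) * deriv γ t).det
      = fredholmDet (fun s t =>
          (∑ ℓ ∈ Finset.range n, q ℓ (γ s) *
            nestedCI (ℓ + 1) ρ (fun v =>
              H (v 0) (γ t) / ((∏ m ∈ Finset.range ℓ, (v m - v (m+1))) *
                ∏ m ∈ Finset.range (ℓ + 1), (v m * P m (v m))))) *
            deriv γ t * (2 * Real.pi * Complex.I)⁻¹) := by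
  have hballΩ : Metric.ball (0 : ℂ) R₀ ⊆ Ω₀ := Metric.ball_subset_closedBall.trans hball
  have hpd : ∀ i < n, DifferentiableOn ℂ (p i) (Metric.ball 0 R₀) := fun i hi v hv =>
    (hp i hi v (hballΩ hv)).differentiableAt.differentiableWithinAt
  have hfd : ∀ i < n, DifferentiableOn ℂ (f i) (Metric.ball 0 R₀) := fun i hi v hv =>
    (hf i hi v (hballΩ hv)).differentiableAt.differentiableWithinAt
  have hHd : ∀ t ∈ Set.Icc (0 : ℝ) 1,
      DifferentiableOn ℂ (fun v => H v (γ t)) (Metric.ball 0 R₀) := fun t ht v hv =>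
    (hH (γ t) (Set.mem_image_of_mem γ ht) v
      (Metric.ball_subset_closedBall hv)).differentiableAt.differentiableWithinAt
  let s : ℕ → ℂ → ℂ := fun m => match m with
    | 0 => fun _ => 1
    | m + 1 => if m < n then p m else fun _ => 1
  have hs_succ : ∀ m < n, s (m + 1) = p m := fun m hm => if_pos hm
  have hsd : ∀ m, DifferentiableOn ℂ (s m) (Metric.ball 0 R₀) := by
    rintro (_ | m)
    · exact differentiableOn_const 1
    · by_cases hm : m < n
      · rw [hs_succ m hm]
        exact hpd m hm
      · simp only [s, if_neg hm]
        exact differentiableOn_const 1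
  have hs0 : ∀ m, ∀ v ∈ Metric.ball 0 R₀, s m v ≠ 0 := by
    rintro (_ | m) v hv
    · exact one_ne_zero
    · by_cases hm : m < n
      · rw [hs_succ m hm]
        exact hpne m hm v (Metric.ball_subset_closedBall hv)
      · simp [s, if_neg hm]
  have hPs' : ∀ m < n, ∀ v, P m v = s (m + 1) v / s m v := by
    rintro (_ | m) hm v
    · rw [hP0, hs_succ 0 hm]
      simp [s]
    · rw [hPs (m + 1) m.succ_pos, hs_succ (m + 1) hm, hs_succ m (by omega), Nat.add_sub_cancel]
  let N : ℕ → ℝ → ℂ := fun ℓ t =>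
    nestedKernel ℓ ρ (fun m v => s (m + 1) v / s m v) fun v => H v (γ t)
  have hN : ∀ ℓ < n, ∀ t, nestedCI (ℓ + 1) ρ (fun v =>
      H (v 0) (γ t) / ((∏ m ∈ Finset.range ℓ, (v m - v (m+1))) *
        ∏ m ∈ Finset.range (ℓ + 1), (v m * P m (v m)))) = N ℓ t := by
    intro ℓ hℓ t
    simp only [N, nestedKernel]
    congr 1
    ext v
    congr 2
    refine Finset.prod_congr rfl fun m hm => ?_
    rw [hPs' m (by rw [mem_range] at hm; omega)]
  set A : Matrix (Fin n) (Fin n) ℂ := Matrix.of fun i j =>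
    cInt r (fun v => v ^ ((i : ℤ) - (j : ℤ) - 1) * p i v * f j v)
  have hAij : ∀ i j : Fin n, A i j =
      if (i : ℕ) ≤ j then taylorCoeff (j - i) (fun v => p i v * f j v) else 0 := fun i j =>
    cInt_zpow_mul_mul hr hrR (hpd i i.2) (hfd j j.2) i j
  have hAdet : A.det = 1 := by
    rw [Matrix.det_of_isUpperTriangular]
    · refine Finset.prod_eq_one fun i _ => ?_
      simp [hAij, taylorCoeff, hp0 i i.2, hf0 i i.2]
    · intro i j hij
      exact (hAij i j).trans (if_neg (not_le.2 hij))
  have hgN : ∀ j : Fin n, ∀ t ∈ Set.Icc (0 : ℝ) 1, g j (γ t) = ∑ ℓ : Fin n, A ℓ j * N ℓ t := by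
    intro j t ht
    have hfsH := (hfd j j.2).fun_mul ((hsd 0).fun_mul (hHd t ht))
    rw [← hg j j.2 (γ t) (Set.mem_image_of_mem γ ht)]
    trans taylorCoeff j (fun v => f j v * (s 0 v * H v (γ t)))
    · rw [← cInt_div_pow_eq_taylorCoeff hr hrR j hfsH]
      refine cInt_congr hr fun v _ => ?_
      simp only [s]
      ring
    · rw [taylorCoeff_mul_eq_sum_nestedKernel j hρpos (hρR 0) hρdec hsd hs0 (hfd j j.2)
        (hHd t ht)]
      let T : ℕ → ℂ := fun ℓ => if ℓ < (j : ℕ) + 1 then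
        taylorCoeff (j - ℓ) (fun v => s (ℓ + 1) v * f j v) * N ℓ t else 0
      have hterm : ∀ ℓ : Fin n, A ℓ j * N ℓ t = T ℓ := by
        intro ℓ
        simp only [T, hAij, hs_succ ℓ ℓ.2, ite_mul, zero_mul, Nat.lt_succ_iff]
      rw [Finset.sum_congr rfl fun ℓ _ => hterm ℓ, Fin.sum_univ_eq_sum_range T, ← Finset.sum_filter]
      refine Finset.sum_congr ?_ fun ℓ _ => rfl
      ext ℓ
      simp only [mem_range, mem_filter]
      have := j.2
      omega
  let a : Fin n → ℝ → ℂ := fun ℓ t => q ℓ (γ t)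
  let b : Fin n → ℝ → ℂ := fun ℓ t => N ℓ t * deriv γ t * (2 * Real.pi * Complex.I)⁻¹
  have hqg : ∀ i j : Fin n, Integrable (fun t => q i (γ t) * g j (γ t) * deriv γ t)
      (volume.restrict (Set.Icc 0 1)) := fun i j =>
    integrable_mul_deriv_of_continuousOn_image hγ
      (φ := fun u => q i u * g j u) ((hqc i i.2).mul (hgc j j.2))
  have hNg : ∀ m : Fin n, ∀ t ∈ Set.Icc (0 : ℝ) 1, N m t = ∑ j : Fin n, g j (γ t) * A⁻¹ j m := by
    intro m t ht
    have hrow : (fun j : Fin n => g j (γ t)) = Matrix.vecMul (fun ℓ : Fin n => N ℓ t) A := by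
      ext j
      rw [hgN j t ht]
      simp only [Matrix.vecMul, dotProduct, mul_comm]
    have := congrFun (congrArg (fun x => Matrix.vecMul x A⁻¹) hrow) m
    simp only [Matrix.vecMul_vecMul] at this
    rw [Matrix.mul_nonsing_inv _ (by rw [hAdet]; exact isUnit_one), Matrix.vecMul_one] at this
    exact this.symm
  have hab : ∀ l m, Integrable (fun t => a l t * b m t) (volume.restrict (Set.Icc 0 1)) := by
    intro l m
    have hsum : Integrable (fun t => ∑ j : Fin n, q l (γ t) * g j (γ t) * deriv γ t *
        (A⁻¹ j m * (2 * Real.pi * Complex.I)⁻¹)) (volume.restrict (Set.Icc 0 1)) :=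
      integrable_finsetSum _ fun j _ => (hqg l j).mul_const _
    refine hsum.congr ((ae_restrict_iff' measurableSet_Icc).2 (ae_of_all _ fun t ht => ?_))
    simp only [a, b]
    rw [hNg m t ht, Finset.sum_mul, Finset.sum_mul, Finset.mul_sum]
    exact Finset.sum_congr rfl fun j _ => by ring
  have hkernel : ∀ x t : ℝ, (∑ ℓ ∈ Finset.range n, q ℓ (γ x) *
      nestedCI (ℓ + 1) ρ (fun v =>
        H (v 0) (γ t) / ((∏ m ∈ Finset.range ℓ, (v m - v (m+1))) *
          ∏ m ∈ Finset.range (ℓ + 1), (v m * P m (v m))))) *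
      deriv γ t * (2 * Real.pi * Complex.I)⁻¹ = ∑ l, a l x * b l t := by
    intro x t
    rw [Finset.sum_congr rfl fun ℓ hℓ => by rw [hN ℓ (mem_range.1 hℓ) t],
      ← Fin.sum_univ_eq_sum_range (fun ℓ => q ℓ (γ x) * N ℓ t), Finset.sum_mul, Finset.sum_mul]
    exact Finset.sum_congr rfl fun l _ => by simp only [a, b]; ring
  simp only [hkernel]
  rw [fredholmDet_sum_mul a b hab, ← mul_one (Matrix.det (1 + _)), ← hAdet, ← Matrix.det_mul,
    add_mul, one_mul]
  congr 1
  ext i j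
  simp only [Matrix.add_apply, Matrix.of_apply, Matrix.mul_apply]
  congr 1
  rw [integral_of_le zero_le_one, ← integral_Icc_eq_integral_Ioc,
    ← MeasureTheory.integral_const_mul]
  simp only [← MeasureTheory.integral_mul_const]
  rw [← integral_finsetSum _ fun m _ => (hab i m).mul_const _]
  refine setIntegral_congr_fun measurableSet_Icc fun t ht => ?_
  simp only [a, b]
  rw [hgN j t ht, Finset.mul_sum, Finset.sum_mul, Finset.mul_sum]
  exact Finset.sum_congr rfl fun m _ => by ring
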